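/- Let A be a real n × n matrix and V₁, V₂ real symmetric n × n matrices, and define on ℝ^{2n} the quadratic forms Re q(y,η) = |η − Ay|² + (1/2)V₁y·y and Im q(y,η) = (1/2)V₂y·y. Then the singular space S = {Y ∈ ℝ^{2n} : (H_{Im q}^k Re q)(Y) = 0 for all k ∈ ℕ} equals the set {(y, Ay) ∈ ℝ^{2n} : V₁y·y = 0 and V₂y = 0}. -/

import Mathlib

open Matrix

noncomputable section

/-- The Hamilton vector field of `f` on `ℝ^{2n}_{y,η}`, applied to `g`:
`H_f g = f'_η · ∂_y g − f'_y · ∂_η g = dg (f'_η, −f'_y)`. -/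
def Ham (n : ℕ) (f : ((Fin n → ℝ) × (Fin n → ℝ)) → ℝ)
    (g : ((Fin n → ℝ) × (Fin n → ℝ)) → ℝ) :
    ((Fin n → ℝ) × (Fin n → ℝ)) → ℝ :=
  fun Y => fderiv ℝ g Y
    (fun i => fderiv ℝ f Y (0, Pi.single i 1),
     fun i => - fderiv ℝ f Y (Pi.single i 1, 0))

/-- The directional derivative of a function which is quadratic along a line. -/
theorem fderiv_apply_eq_of_quadratic_on_line {E : Type*} [NormedAddCommGroup E] [NormedSpace ℝ E]
    {f : E → ℝ} {x v : E} {c d : ℝ} (hf : DifferentiableAt ℝ f x)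
    (h : ∀ t : ℝ, f (x + t • v) = f x + t * c + t ^ 2 * d) : fderiv ℝ f x v = c := by
  rw [← hf.lineDeriv_eq_fderiv, lineDeriv]
  have hquad : HasDerivAt (fun t : ℝ => f x + t * c + t ^ 2 * d) c 0 := by
    refine ((((hasDerivAt_id (0 : ℝ)).mul_const c).const_add (f x)).add
      ((hasDerivAt_pow 2 (0 : ℝ)).mul_const d)).congr_deriv ?_
    simp
  simpa only [h] using hquad.deriv

/-- The Hamilton vector field of the potential `V y · y / 2` is `-V y · ∂_η`. -/
theorem Ham_half_quadratic_form {n : ℕ} {V : Matrix (Fin n) (Fin n) ℝ} (hV : V.IsSymm)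
    (g : (Fin n → ℝ) × (Fin n → ℝ) → ℝ) (Y : (Fin n → ℝ) × (Fin n → ℝ)) :
    Ham n (fun Y => (1 / 2) * ((V *ᵥ Y.1) ⬝ᵥ Y.1)) g Y = fderiv ℝ g Y (0, -(V *ᵥ Y.1)) := by
  have hd : DifferentiableAt ℝ
      (fun Y : (Fin n → ℝ) × (Fin n → ℝ) => (1 / 2) * ((V *ᵥ Y.1) ⬝ᵥ Y.1)) Y := by
    simp only [dotProduct, mulVec]
    fun_prop
  have hsymm (u w : Fin n → ℝ) : (V *ᵥ u) ⬝ᵥ w = (V *ᵥ w) ⬝ᵥ u := by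
    rw [dotProduct_comm, dotProduct_mulVec, ← mulVec_transpose, hV.eq]
  unfold Ham
  congr 2
  · funext i
    refine fderiv_apply_eq_of_quadratic_on_line (d := 0) hd fun t => ?_
    simp
  · funext i
    rw [Pi.neg_apply, neg_inj]
    refine fderiv_apply_eq_of_quadratic_on_line
      (d := (1 / 2) * ((V *ᵥ Pi.single i 1) ⬝ᵥ Pi.single i 1)) hd fun t => ?_
    have hi : (V *ᵥ Y.1) ⬝ᵥ Pi.single i 1 = (V *ᵥ Y.1) i := by simp
    simp only [Prod.fst_add, Prod.smul_fst, mulVec_add, mulVec_smul, add_dotProduct,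
      dotProduct_add, smul_dotProduct, dotProduct_smul, smul_eq_mul,
      hsymm (Pi.single i 1) Y.1, hi]
    ring

/-- for the quadratic magnetic Schrödinger symbol with `Re q ≥ 0`
(`V₁` positive semidefinite), the singular space
`S = {Y : H_{Im q}^k Re q (Y) = 0 for all k ∈ ℕ}` equals
`{(y, Ay) : V₁y·y = 0 and V₂y = 0}`. -/
theorem singular_space_of_quadratic_symbol
    (n : ℕ) (A V₁ V₂ : Matrix (Fin n) (Fin n) ℝ)
    (h₁ : V₁.IsSymm) (h₂ : V₂.IsSymm) (hpsd : V₁.PosSemidef)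
    (Req Imq : ((Fin n → ℝ) × (Fin n → ℝ)) → ℝ)
    (hReq : ∀ Y, Req Y = (Y.2 - A *ᵥ Y.1) ⬝ᵥ (Y.2 - A *ᵥ Y.1)
        + (1/2) * ((V₁ *ᵥ Y.1) ⬝ᵥ Y.1))
    (hImq : ∀ Y, Imq Y = (1/2) * ((V₂ *ᵥ Y.1) ⬝ᵥ Y.1)) :
    {Y : (Fin n → ℝ) × (Fin n → ℝ) | ∀ k : ℕ, (Ham n Imq)^[k] Req Y = 0}
      = {Y : (Fin n → ℝ) × (Fin n → ℝ) |
          Y.2 = A *ᵥ Y.1 ∧ (V₁ *ᵥ Y.1) ⬝ᵥ Y.1 = 0 ∧ V₂ *ᵥ Y.1 = 0} := by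
  obtain rfl : Req = _ := funext hReq
  obtain rfl : Imq = _ := funext hImq
  set H := Ham n (fun Y => (1 / 2) * ((V₂ *ᵥ Y.1) ⬝ᵥ Y.1)) with hH
  have ham_symbol : H (fun Y => (Y.2 - A *ᵥ Y.1) ⬝ᵥ (Y.2 - A *ᵥ Y.1) + (1/2) * ((V₁ *ᵥ Y.1) ⬝ᵥ Y.1))
      = fun Y => -2 * ((Y.2 - A *ᵥ Y.1) ⬝ᵥ (V₂ *ᵥ Y.1)) := by
    funext Y
    rw [hH, Ham_half_quadratic_form h₂]
    refine fderiv_apply_eq_of_quadratic_on_line (d := (V₂ *ᵥ Y.1) ⬝ᵥ (V₂ *ᵥ Y.1)) ?_ fun t => ?_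
    · simp only [dotProduct, mulVec, Pi.sub_apply]
      fun_prop
    · simp only [Prod.fst_add, Prod.smul_fst, Prod.snd_add, Prod.smul_snd, smul_zero, add_zero,
        add_sub_right_comm _ (-(t • (V₂ *ᵥ Y.1))), smul_neg, add_dotProduct, dotProduct_add,
        neg_dotProduct, dotProduct_neg, smul_dotProduct, dotProduct_smul, smul_eq_mul,
        dotProduct_comm (V₂ *ᵥ Y.1) (Y.2 - A *ᵥ Y.1)]
      ring
  have ham_cross_term : H (fun Y => -2 * ((Y.2 - A *ᵥ Y.1) ⬝ᵥ (V₂ *ᵥ Y.1)))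
      = fun Y => 2 * ((V₂ *ᵥ Y.1) ⬝ᵥ (V₂ *ᵥ Y.1)) := by
    funext Y
    rw [hH, Ham_half_quadratic_form h₂]
    refine fderiv_apply_eq_of_quadratic_on_line (d := 0) ?_ fun t => ?_
    · simp only [dotProduct, mulVec, Pi.sub_apply]
      fun_prop
    · simp only [Prod.fst_add, Prod.smul_fst, Prod.snd_add, Prod.smul_snd, smul_zero, add_zero,
        add_sub_right_comm _ (-(t • (V₂ *ᵥ Y.1))), smul_neg, add_dotProduct,
        neg_dotProduct, smul_dotProduct, smul_eq_mul]
      ring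
  have ham_norm_sq : H (fun Y => 2 * ((V₂ *ᵥ Y.1) ⬝ᵥ (V₂ *ᵥ Y.1))) = fun _ => 0 := by
    funext Y
    rw [hH, Ham_half_quadratic_form h₂]
    refine fderiv_apply_eq_of_quadratic_on_line (d := 0) ?_ fun t => ?_
    · simp only [dotProduct, mulVec]
      fun_prop
    · simp
  have ham_zero : H (fun _ => 0) = fun _ => 0 := by
    funext Y
    rw [hH, Ham_half_quadratic_form h₂]
    simp
  ext Y
  simp only [Set.mem_ofPred_eq]
  constructor
  · intro h
    have e0 := h 0
    have e2 := h 2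
    simp only [Function.iterate_succ_apply, Function.iterate_zero, id_eq, ham_symbol, ham_cross_term] at e0 e2
    have hV₁ : 0 ≤ (V₁ *ᵥ Y.1) ⬝ᵥ Y.1 := by
      simpa [dotProduct_comm] using hpsd.dotProduct_mulVec_nonneg Y.1
    have hη : 0 ≤ (Y.2 - A *ᵥ Y.1) ⬝ᵥ (Y.2 - A *ᵥ Y.1) :=
      Finset.sum_nonneg fun i _ => mul_self_nonneg _
    refine ⟨sub_eq_zero.1 (dotProduct_self_eq_zero.1 ?_), ?_, dotProduct_self_eq_zero.1 ?_⟩ <;>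
      linarith
  · rintro ⟨hη, hV₁, hV₂⟩ k
    match k with
    | 0 => simp [hη, hV₁]
    | 1 => simp only [Function.iterate_one, ham_symbol, hη, sub_self, zero_dotProduct, mul_zero]
    | 2 => simp only [Function.iterate_succ_apply, Function.iterate_zero, id_eq, ham_symbol, ham_cross_term,
        hV₂, zero_dotProduct, mul_zero]
    | k + 3 =>
      simp only [Function.iterate_succ_apply, ham_symbol, ham_cross_term, ham_norm_sq, Function.iterate_fixed ham_zero]
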